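/- arXiv:1312.6589 — 2 statements merged into one kernel-verified Lean document; each statement's English description precedes it below -/
import Mathlib

section
/- Let X be a nonempty metrizable topological space. The space P(X) of Borel probability measures on X, equipped with the topology of weak convergence, is separable (as a topological space) if and only if X is separable. -/
open MeasureTheory

open Filter Set Topology TopologicalSpace
open scoped ENNReal BoundedContinuousFunction

/-- Every pseudometric space contains a maximal `ε`-separated set, which is then an `ε`-net. -/
theorem exists_pairwise_lt_dist_forall_exists_dist_le {X : Type*} [PseudoMetricSpace X]
    {ε : ℝ} (hε : 0 ≤ ε) :
    ∃ s : Set X, s.Pairwise (fun x y ↦ ε < dist x y) ∧ ∀ x, ∃ y ∈ s, dist x y ≤ ε := by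
  obtain ⟨s, hs⟩ := zorn_subset {s : Set X | s.Pairwise fun x y ↦ ε < dist x y}
    fun c hc hchain ↦ ⟨⋃₀ c, (pairwise_sUnion hchain.directedOn).2 fun t ht ↦ hc ht,
      fun t ht ↦ subset_sUnion_of_mem ht⟩
  refine ⟨s, hs.prop, fun x ↦ ?_⟩
  by_contra! h
  have hins : insert x s ∈ {s : Set X | s.Pairwise fun x y ↦ ε < dist x y} :=
    hs.prop.insert fun y hy _ ↦ ⟨h y hy, dist_comm x y ▸ h y hy⟩
  have hx : x ∈ s := hs.le_of_ge hins (subset_insert x s) (mem_insert x s)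
  exact absurd (h x hx) (by simpa using hε)

/-- Charging a fixed open set is an open condition on probability measures. -/
theorem MeasureTheory.ProbabilityMeasure.isOpen_setOf_measure_pos {X : Type*}
    [TopologicalSpace X] [MeasurableSpace X] [OpensMeasurableSpace X] [HasOuterApproxClosed X]
    {G : Set X} (hG : IsOpen G) :
    IsOpen {μ : ProbabilityMeasure X | 0 < (μ : Measure X) G} := by
  refine isOpen_iff_mem_nhds.2 fun μ hμ ↦ ?_
  exact eventually_lt_of_lt_liminf
    (lt_of_lt_of_le hμ (ProbabilityMeasure.le_liminf_measure_open_of_tendsto tendsto_id hG))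

/-- A metrizable space is separable if its space of Borel probability measures is. -/
theorem MeasureTheory.ProbabilityMeasure.separableSpace_of_separableSpace {X : Type*}
    [TopologicalSpace X] [PseudoMetrizableSpace X] [MeasurableSpace X] [OpensMeasurableSpace X]
    [SeparableSpace (ProbabilityMeasure X)] : SeparableSpace X := by
  let : PseudoMetricSpace X := pseudoMetrizableSpacePseudoMetric X
  suffices SecondCountableTopology X by infer_instance
  refine Metric.secondCountable_of_almost_dense_set fun ε hε ↦ ?_
  obtain ⟨s, hsep, hnet⟩ := exists_pairwise_lt_dist_forall_exists_dist_le (X := X) hε.le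
  refine ⟨s, ?_, hnet⟩
  obtain ⟨D, hD, hDense⟩ := exists_countable_dense (ProbabilityMeasure X)
  have hdisj : Pairwise (Function.onFun Disjoint fun x : s ↦ Metric.ball (x : X) (ε / 2)) :=
    fun x y hxy ↦ Metric.ball_disjoint_ball <| by
      linarith [hsep x.2 y.2 (Subtype.coe_injective.ne hxy)]
  have hcount :
      (⋃ μ ∈ D, {x : s | 0 < (μ : Measure X) (Metric.ball (x : X) (ε / 2))}).Countable :=
    hD.biUnion fun μ _ ↦ Measure.countable_meas_pos_of_disjoint_iUnion
      (fun _ ↦ Metric.isOpen_ball.measurableSet) hdisj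
  rw [← countable_coe_iff, ← countable_univ_iff]
  refine hcount.mono fun x _ ↦ ?_
  obtain ⟨μ, hμ, hμD⟩ := hDense.inter_open_nonempty _
    (ProbabilityMeasure.isOpen_setOf_measure_pos (Metric.isOpen_ball (x := (x : X)) (ε := ε / 2)))
    ⟨diracProba (x : X), by
      simp [diracProba_toMeasure_apply' _ Metric.isOpen_ball.measurableSet, hε]⟩
  exact mem_biUnion hμD hμ

/-- If measurable maps `f n` converge pointwise to the identity, then the push-forwards of `μ`
under `f n` converge weakly to `μ`. -/
theorem MeasureTheory.ProbabilityMeasure.tendsto_map_of_forall_tendsto_self {X : Type*}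
    [TopologicalSpace X] [MeasurableSpace X] [OpensMeasurableSpace X]
    (μ : ProbabilityMeasure X) {f : ℕ → X → X} (hf : ∀ n, Measurable (f n))
    (hlim : ∀ x, Tendsto (fun n ↦ f n x) atTop (𝓝 x)) :
    Tendsto (fun n ↦ μ.map (hf n).aemeasurable) atTop (𝓝 μ) := by
  refine ProbabilityMeasure.tendsto_iff_forall_integral_tendsto.2 fun g ↦ ?_
  have hg : StronglyMeasurable g := g.continuous.measurable.stronglyMeasurable
  simp_rw [ProbabilityMeasure.toMeasure_map,
    integral_map (hf _).aemeasurable hg.aestronglyMeasurable]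
  exact tendsto_integral_of_dominated_convergence (fun _ ↦ ‖g‖)
    (fun n ↦ (hg.comp_measurable (hf n)).aestronglyMeasurable) (integrable_const _)
    (fun n ↦ .of_forall fun x ↦ g.norm_coe_le_norm _)
    (.of_forall fun x ↦ (g.continuous.tendsto x).comp (hlim x))

/-- The space of Borel probability measures on a separable metrizable space is separable:
the measures supported on finitely many terms of a dense sequence are dense. -/
instance MeasureTheory.ProbabilityMeasure.instSeparableSpace {X : Type*}
    [TopologicalSpace X] [PseudoMetrizableSpace X] [SeparableSpace X] [MeasurableSpace X]
    [BorelSpace X] : SeparableSpace (ProbabilityMeasure X) := by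
  let : PseudoMetricSpace X := pseudoMetrizableSpacePseudoMetric X
  rcases isEmpty_or_nonempty X with _ | _
  · have : IsEmpty (ProbabilityMeasure X) :=
      ⟨fun μ ↦ (μ : Measure X).nonempty_of_neZero.elim isEmptyElim⟩
    infer_instance
  let e := denseSeq X
  have hcont (N : ℕ) : Continuous fun i : Fin (N + 1) ↦ e i := continuous_of_discreteTopology
  have hsep (N : ℕ) : SeparableSpace (ProbabilityMeasure (Fin (N + 1))) := by
    let := metrizableSpaceMetric (ProbabilityMeasure (Fin (N + 1)))
    infer_instance
  have hunion : TopologicalSpace.IsSeparable (⋃ N, range fun ν : ProbabilityMeasure (Fin (N + 1)) ↦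
      ν.map (hcont N).measurable.aemeasurable) :=
    .iUnion fun N ↦ isSeparable_range (ProbabilityMeasure.continuous_map (hcont N))
  refine isSeparable_univ_iff.1 (hunion.closure.mono fun μ _ ↦ ?_)
  refine mem_closure_of_tendsto (μ.tendsto_map_of_forall_tendsto_self
    (fun N ↦ (SimpleFunc.nearestPt e N).measurable)
    fun x ↦ SimpleFunc.tendsto_nearestPt (denseRange_denseSeq X x)) (.of_forall fun N ↦ ?_)
  let g : X → Fin (N + 1) := fun x ↦
    ⟨SimpleFunc.nearestPtInd e N x, Nat.lt_succ_of_le (SimpleFunc.nearestPtInd_le e N x)⟩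
  have hg : Measurable g := measurable_to_countable' fun i ↦ by
    simpa [g, preimage, Fin.ext_iff] using
      (SimpleFunc.nearestPtInd e N).measurableSet_fiber (i : ℕ)
  refine mem_iUnion.2 ⟨N, μ.map hg.aemeasurable, Subtype.ext ?_⟩
  exact Measure.map_map (hcont N).measurable hg

/-- For a nonempty metrizable space `X`, the space of Borel probability measures on `X`
with the topology of weak convergence is separable iff `X` is separable. -/
theorem probabilityMeasure_separable_iff_separable
    (X : Type*) [TopologicalSpace X] [TopologicalSpace.MetrizableSpace X] [Nonempty X]
    [MeasurableSpace X] [BorelSpace X] :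
    TopologicalSpace.SeparableSpace (ProbabilityMeasure X) ↔
      TopologicalSpace.SeparableSpace X :=
  ⟨fun _ ↦ ProbabilityMeasure.separableSpace_of_separableSpace, fun _ ↦ inferInstance⟩
end

section
/- Let X be a nonempty metrizable topological space. The space P(X) of Borel probability measures on X, equipped with the topology of weak convergence, is a Polish space if and only if X is a Polish space. -/
open MeasureTheory

open Filter Topology Set TopologicalSpace ProbabilityTheory
open scoped ENNReal NNReal

/-- The range of `diracProba` is closed: the variance of a bounded continuous function depends
continuously on the measure, so every limit of Dirac masses gives it zero variance. -/
theorem isClosed_range_diracProba {X : Type*} [TopologicalSpace X] [MetrizableSpace X]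
    [SecondCountableTopology X] [MeasurableSpace X] [BorelSpace X] :
    IsClosed (range (diracProba : X → ProbabilityMeasure X)) := by
  let := metrizableSpaceMetric X
  refine isClosed_of_closure_subset fun μ hμ ↦ ?_
  obtain ⟨x, hx⟩ := Measure.nonempty_support (IsProbabilityMeasure.ne_zero (μ : Measure X))
  let f : BoundedContinuousFunction X ℝ := BoundedContinuousFunction.mkOfBound
    ⟨fun z ↦ min (dist z x) 1, by fun_prop⟩ 1 fun y z ↦ by
      refine Real.dist_le_of_mem_Icc_01 ⟨?_, ?_⟩ ⟨?_, ?_⟩ <;> simp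
  have hf (z : X) : f z = min (dist z x) 1 := rfl
  have hsq : ∫ z, (f * f) z ∂(μ : Measure X) = (∫ z, f z ∂(μ : Measure X)) ^ 2 := by
    have hcl : IsClosed {ν : ProbabilityMeasure X |
        ∫ z, (f * f) z ∂(ν : Measure X) = (∫ z, f z ∂(ν : Measure X)) ^ 2} :=
      isClosed_eq (ProbabilityMeasure.continuous_integral_boundedContinuousFunction _)
        ((ProbabilityMeasure.continuous_integral_boundedContinuousFunction _).pow 2)
    refine hcl.closure_subset_iff.2 ?_ hμ
    rintro _ ⟨y, rfl⟩
    change ∫ z, (f * f) z ∂(Measure.dirac y) = (∫ z, f z ∂(Measure.dirac y)) ^ 2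
    simp [pow_two]
  have hmem : MemLp f 2 (μ : Measure X) := 
    MemLp.of_bound f.continuous.aestronglyMeasurable ‖f‖ (ae_of_all _ f.norm_coe_le_norm)
  have hae := ae_eq_integral_of_variance_eq_zero hmem (by
    rw [variance_eq_sub hmem, sub_eq_zero, ← hsq]
    simp [pow_two])
  set c := ∫ z, f z ∂(μ : Measure X)
  have hc : c ≤ 0 := by
    by_contra! hc
    have hball : Metric.ball x c ∈ 𝓝 x := Metric.ball_mem_nhds x hc
    have hpos := (Measure.mem_support_iff_forall x).1 hx _ hball
    refine hpos.ne' (measure_mono_null (fun z hz ↦ ?_) hae)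
    have : f z < c := (min_le_left _ _).trans_lt hz
    exact this.ne
  have hdirac : ∀ᵐ z ∂(μ : Measure X), z = x := by
    filter_upwards [hae] with z hz
    have h1 : min (dist z x) 1 ≤ 0 := by rw [← hf, hz]; exact hc
    rcases min_le_iff.1 h1 with h | h
    · exact dist_le_zero.1 h
    · norm_num at h
  refine ⟨x, ProbabilityMeasure.toMeasure_injective ?_⟩
  change Measure.dirac x = (μ : Measure X)
  rw [← Measure.map_id (μ := (μ : Measure X)),
    Measure.map_congr (show id =ᵐ[(μ : Measure X)] fun _ ↦ x from hdirac), Measure.map_const]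
  simp

/-- Push-forward along an inducing map between spaces of probability measures is inducing. -/
theorem isInducing_probabilityMeasure_map {X Y : Type*} [TopologicalSpace X] [MeasurableSpace X]
    [BorelSpace X] [TopologicalSpace Y] [MeasurableSpace Y] [BorelSpace Y]
    [HasOuterApproxClosed Y] [FirstCountableTopology (ProbabilityMeasure Y)]
    {f : X → Y} (hf : IsInducing f) :
    IsInducing fun μ : ProbabilityMeasure X ↦ μ.map hf.continuous.measurable.aemeasurable := by
  refine isInducing_iff_nhds.2 fun μ ↦ le_antisymm ?_ ?_
  · exact (ProbabilityMeasure.continuous_map hf.continuous).continuousAt.le_comap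
  · let L := comap (fun ν : ProbabilityMeasure X ↦
      ν.map hf.continuous.measurable.aemeasurable)
      (𝓝 (μ.map hf.continuous.measurable.aemeasurable))
    refine tendsto_of_forall_isOpen_le_liminf' (μs := id) (L := L) fun G hG ↦ ?_
    obtain ⟨U, hU, rfl⟩ := hf.isOpen_iff.1 hG
    have h := ProbabilityMeasure.le_liminf_measure_open_of_tendsto (L := L) tendsto_comap hU
    simpa only [id, ProbabilityMeasure.map_apply' _ _ hU.measurableSet] using h

/-- A separable metrizable space has a second countable space of probability measures, as it embeds
in the compact metrizable space of probability measures on the Hilbert cube. -/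
theorem secondCountableTopology_probabilityMeasure {X : Type*} [TopologicalSpace X]
    [MetrizableSpace X] [SecondCountableTopology X] [MeasurableSpace X] [BorelSpace X] :
    SecondCountableTopology (ProbabilityMeasure X) := by
  let := metrizableSpaceMetric X
  obtain ⟨F, hF⟩ := Metric.PiNatEmbed.exists_embedding_to_hilbert_cube (X := X)
  let := metrizableSpaceMetric (ProbabilityMeasure (ℕ → unitInterval))
  exact (isInducing_probabilityMeasure_map hF.isInducing).secondCountableTopology

section Complete

variable {X : Type*} [MetricSpace X] [CompleteSpace X] [SecondCountableTopology X]
  [MeasurableSpace X] [BorelSpace X]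

/-- For a family of probability measures totally bounded for the Lévy–Prokhorov metric, there are
compact sets whose arbitrarily small thickenings uniformly carry almost all the mass. -/
theorem exists_isCompact_measure_compl_cthickening_le
    {S : Set (LevyProkhorov (ProbabilityMeasure X))} (hS : TotallyBounded S)
    {c : ℝ≥0} (hc : 0 < c) :
    ∃ K : Set X, IsCompact K ∧
      ∀ μ ∈ S, (μ.toMeasure : Measure X) (Metric.cthickening c K)ᶜ ≤ 2 * c := by
  obtain ⟨t, ht, hSt⟩ := EMetric.totallyBounded_iff.1 hS c (by simpa using hc)
  have hK (ν : LevyProkhorov (ProbabilityMeasure X)) :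
      ∃ K : Set X, IsCompact K ∧ (ν.toMeasure : Measure X) Kᶜ ≤ c := by
    simpa using isTightMeasureSet_iff_exists_isCompact_measure_compl_le.1
      (isTightMeasureSet_singleton (μ := (ν.toMeasure : Measure X))) c (by simpa using hc)
  choose K hK hνK using hK
  refine ⟨⋃ ν ∈ t, K ν, ht.isCompact_biUnion fun ν _ ↦ hK ν, fun μ hμ ↦ ?_⟩
  obtain ⟨ν, hν, hμν⟩ := mem_iUnion₂.1 (hSt hμ)
  have hd : levyProkhorovEDist (ν.toMeasure : Measure X) (μ.toMeasure : Measure X) < c := by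
    rw [levyProkhorovEDist_comm]
    exact hμν
  have h1 := left_measure_le_of_levyProkhorovEDist_lt hd (hK ν).measurableSet
  have h2 : (μ.toMeasure : Measure X) (Metric.thickening c (K ν)) ≤
      (μ.toMeasure : Measure X) (Metric.cthickening c (⋃ ν ∈ t, K ν)) :=
    measure_mono ((Metric.thickening_subset_cthickening _ _).trans
      (Metric.cthickening_subset_of_subset _ (subset_biUnion_of_mem (u := K) hν)))
  rw [prob_compl_eq_one_sub Metric.isClosed_cthickening.measurableSet, tsub_le_iff_left]
  calc (1 : ℝ≥0∞) = (ν.toMeasure : Measure X) (K ν) + (ν.toMeasure : Measure X) (K ν)ᶜ :=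
        (prob_add_prob_compl (hK ν).measurableSet).symm
    _ ≤ ((μ.toMeasure : Measure X) (Metric.cthickening c (⋃ ν ∈ t, K ν)) + c) + c :=
        add_le_add (h1.trans (add_le_add_left (by simpa using! h2) _)) (hνK ν)
    _ = _ := by ring

/-- Over a complete separable metric space, sets of probability measures that are totally bounded
for the Lévy–Prokhorov metric are tight. -/
theorem isTightMeasureSet_of_totallyBounded_levyProkhorov
    {S : Set (LevyProkhorov (ProbabilityMeasure X))} (hS : TotallyBounded S) :
    IsTightMeasureSet {(μ.toMeasure : Measure X) | μ ∈ S} := by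
  rw [isTightMeasureSet_iff_exists_isCompact_measure_compl_le]
  intro ε hε
  obtain ⟨u, hu, hsum⟩ := ENNReal.exists_pos_sum_of_countable (ENNReal.half_pos hε.ne').ne' ℕ
  choose K hK hμK using fun n ↦ exists_isCompact_measure_compl_cthickening_le hS (hu n)
  refine ⟨⋂ n, Metric.cthickening (u n) (K n), ?_, ?_⟩
  · refine TotallyBounded.isCompact_of_isClosed ?_
      (isClosed_iInter fun n ↦ Metric.isClosed_cthickening)
    refine Metric.totallyBounded_iff.2 fun δ hδ ↦ ?_
    have hlim : Tendsto u atTop (𝓝 0) := by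
      rw [← Nat.cofinite_eq_atTop]
      exact NNReal.tendsto_cofinite_zero_of_summable
        (ENNReal.tsum_coe_ne_top_iff_summable.1 (hsum.trans_le le_top).ne)
    obtain ⟨n, hn⟩ := ((NNReal.tendsto_coe.2 hlim).eventually_lt_const (half_pos hδ)).exists
    obtain ⟨t, ht, hKt⟩ := Metric.totallyBounded_iff.1 (hK n).totallyBounded _ (half_pos hδ)
    refine ⟨t, ht, fun x hx ↦ ?_⟩
    obtain ⟨z, hz, hxz⟩ := Metric.mem_thickening_iff.1
      (Metric.cthickening_subset_thickening' (half_pos hδ) hn _ (mem_iInter.1 hx n))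
    obtain ⟨y, hy, hzy⟩ := mem_iUnion₂.1 (hKt hz)
    refine mem_iUnion₂.2 ⟨y, hy, ?_⟩
    rw [Metric.mem_ball] at hzy ⊢
    linarith [dist_triangle x z y]
  · rintro _ ⟨μ, hμ, rfl⟩
    rw [compl_iInter]
    calc (μ.toMeasure : Measure X) (⋃ n, (Metric.cthickening (u n) (K n))ᶜ)
        ≤ ∑' n, (μ.toMeasure : Measure X) (Metric.cthickening (u n) (K n))ᶜ :=
          measure_iUnion_le _
      _ ≤ ∑' n, 2 * (u n : ℝ≥0∞) := ENNReal.tsum_le_tsum fun n ↦ hμK n μ hμ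
      _ = 2 * ∑' n, (u n : ℝ≥0∞) := ENNReal.tsum_mul_left
      _ ≤ 2 * (ε / 2) := by gcongr
      _ = ε := ENNReal.mul_div_cancel (by simp) (by simp)

/-- The Lévy–Prokhorov metric over a complete separable metric space is complete. -/
theorem completeSpace_levyProkhorov_probabilityMeasure :
    CompleteSpace (LevyProkhorov (ProbabilityMeasure X)) := by
  refine Metric.complete_of_cauchySeq_tendsto fun u hu ↦ ?_
  have htight := isTightMeasureSet_of_totallyBounded_levyProkhorov hu.totallyBounded_range
  have hcomp : IsCompact (closure (range fun n ↦ (u n).toMeasure)) :=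
    isCompact_closure_of_isTightMeasureSet (by simpa using htight)
  obtain ⟨μ, -, φ, hφ, hlim⟩ := hcomp.tendsto_subseq fun n ↦ subset_closure (mem_range_self n)
  refine ⟨LevyProkhorov.ofMeasure μ, tendsto_nhds_of_cauchySeq_of_subseq hu hφ.tendsto_atTop ?_⟩
  exact (LevyProkhorov.continuous_ofMeasure_probabilityMeasure.tendsto μ).comp hlim

end Complete

/-- For a nonempty metrizable space `X`, the space of Borel probability measures on `X`
with the topology of weak convergence is Polish iff `X` is Polish. -/
theorem probabilityMeasure_polishSpace_iff_polishSpace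
    (X : Type*) [TopologicalSpace X] [TopologicalSpace.MetrizableSpace X] [Nonempty X]
    [MeasurableSpace X] [BorelSpace X] :
    PolishSpace (ProbabilityMeasure X) ↔ PolishSpace X := by
  refine ⟨fun _ ↦ ?_, fun _ ↦ ?_⟩
  · have hemb : IsEmbedding (diracProba : X → ProbabilityMeasure X) := isEmbedding_diracProba
    have := hemb.secondCountableTopology
    exact IsClosedEmbedding.polishSpace ⟨hemb, isClosed_range_diracProba⟩
  · let := upgradeIsCompletelyMetrizable X
    have := secondCountableTopology_probabilityMeasure (X := X)
    let e := LevyProkhorov.probabilityMeasureHomeomorph (Ω := X)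
    have := completeSpace_levyProkhorov_probabilityMeasure (X := X)
    have := e.symm.isEmbedding.secondCountableTopology
    have : PolishSpace (LevyProkhorov (ProbabilityMeasure X)) := inferInstance
    exact e.isClosedEmbedding.polishSpace
end
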